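/- Assume additionally that p is σ(S_l)-measurable for every l ∈ 𝓛_k. Then v★ ∈ 𝒱_k attains inf_{v ∈ 𝒱_k} MSE_k(v) if and only if v★ satisfies, for every l ∈ 𝓛_k, the almost-sure identity v★_l = ( E[H_l P H_lᴴ | σ(S_l)] + I_N )⁻¹ ( E[H_l | σ(S_l)] P^{1/2} e_k − Σ_{j ∈ 𝓛_k∖{l}} E[H_l P H_jᴴ v★_j | σ(S_l)] ), where P := diag(p_1, …, p_K), P^{1/2} := diag(√p_1, …, √p_K), and e_k is the k-th standard basis vector of ℂ^K. Moreover, there is at most one element of 𝒱_k satisfying these identities (so the MSE minimizer, when it exists, is unique). -/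

import Mathlib

open MeasureTheory ProbabilityTheory Matrix Finset
open scoped ENNReal ComplexConjugate MeasureTheory

noncomputable section

/-- The canonical uplink massive MIMO model with `K` users and `M = N·L` infrastructure
antennas partitioned into `L` groups of `N` antennas (rows indexed by `Fin L × Fin N`),
with distributed CSI `S l` (the CSI of processing unit `l`) taking values in `𝓢 l`. -/
structure DistUplinkModel (Ω : Type*) [MeasureSpace Ω] (K N L : ℕ)
    (𝓢 : Fin L → Type*) [∀ l, MeasurableSpace (𝓢 l)] where
  x : Fin K → Ω → ℂ
  z : Ω → Fin L × Fin N → ℂ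
  H : Ω → Fin L × Fin N → Fin K → ℂ
  S : ∀ l, Ω → 𝓢 l
  p : Ω → Fin K → ℝ
  hx_meas : ∀ j, Measurable (x j)
  hz_meas : Measurable z
  hH_meas : Measurable H
  hS_meas : ∀ l, Measurable (S l)
  hx_L2 : ∀ j, MemLp (x j) 2 ℙ
  hz_L2 : ∀ i, MemLp (fun ω => z ω i) 2 ℙ
  hx_mean : ∀ j, ∫ ω, x j ω = 0
  hx_var : ∀ j, ∫ ω, ‖x j ω‖ ^ 2 = 1
  hz_mean : ∀ i, ∫ ω, z ω i = 0
  hz_cov : ∀ i i', ∫ ω, z ω i * conj (z ω i') = if i = i' then 1 else 0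
  hp_nonneg : ∀ ω j, 0 ≤ p ω j
  hp_meas : Measurable[MeasurableSpace.comap (fun ω l => S l ω) inferInstance] p
  hp_bdd : ∃ C : ℝ, ∀ᵐ ω, ∀ j, p ω j ≤ C
  /-- `(x 0, …, x (K-1))`, `z` and the pair `(H, S)` are mutually independent. -/
  hindep : iIndep (fun i : Fin K ⊕ Bool =>
    Sum.elim (fun j => MeasurableSpace.comap (x j) inferInstance)
      (fun b => if b then
          MeasurableSpace.comap (fun ω => (H ω, fun l => S l ω)) inferInstance
        else MeasurableSpace.comap z inferInstance) i) ℙ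
  /-- `E[‖H Hᴴ‖_F²] < ∞`. -/
  hHHherm_L2 : Integrable (fun ω =>
    ∑ i, ∑ i', ‖(Matrix.of (H ω) * (Matrix.of (H ω))ᴴ) i i'‖ ^ 2)

namespace DistUplinkModel

variable {Ω : Type*} [MeasureSpace Ω] {K N L : ℕ} {𝓢 : Fin L → Type*}
  [∀ l, MeasurableSpace (𝓢 l)]

/-- The σ-algebra `σ(S_l)` generated by the CSI of processing unit `l`. -/
def mS (Mo : DistUplinkModel Ω K N L 𝓢) (l : Fin L) : MeasurableSpace Ω :=
  MeasurableSpace.comap (Mo.S l) inferInstance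

/-- The received uplink signal `r = ∑ j √(p j) • h j * x j + z`. -/
def r (Mo : DistUplinkModel Ω K N L 𝓢) (ω : Ω) : Fin L × Fin N → ℂ := fun i =>
  (∑ j, (Real.sqrt (Mo.p ω j) : ℂ) * Mo.H ω i j * Mo.x j ω) + Mo.z ω i

/-- `g j v = √(p j) h jᴴ v`. -/
def g (Mo : DistUplinkModel Ω K N L 𝓢) (j : Fin K) (v : Ω → Fin L × Fin N → ℂ) (ω : Ω) : ℂ :=
  (Real.sqrt (Mo.p ω j) : ℂ) * ∑ i, conj (Mo.H ω i j) * v ω i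

/-- `MSE k v = E[|x k − vᴴ r|²]`. -/
def MSE (Mo : DistUplinkModel Ω K N L 𝓢) (k : Fin K) (v : Ω → Fin L × Fin N → ℂ) : ℝ :=
  ∫ ω, ‖Mo.x k ω - ∑ i, conj (v ω i) * Mo.r ω i‖ ^ 2

/-- `MSE_k(v | U) = E[|x k − vᴴ r|² | U]`, as conditional expectation given the σ-algebra `m`. -/
def MSEcond (Mo : DistUplinkModel Ω K N L 𝓢) (m : MeasurableSpace Ω) (k : Fin K)
    (v : Ω → Fin L × Fin N → ℂ) : Ω → ℝ :=
  ℙ[fun ω => ‖Mo.x k ω - ∑ i, conj (v ω i) * Mo.r ω i‖ ^ 2 | m]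

/-- The use-and-then-forget SINR (with the convention `0/0 = 0`, which is automatic for real
division in Lean). -/
def SINR_UatF (Mo : DistUplinkModel Ω K N L 𝓢) (k : Fin K)
    (v : Ω → Fin L × Fin N → ℂ) : ℝ :=
  ‖∫ ω, Mo.g k v ω‖ ^ 2 /
    (((∫ ω, ‖Mo.g k v ω‖ ^ 2) - ‖∫ ω, Mo.g k v ω‖ ^ 2)
      + (∑ j ∈ Finset.univ.erase k, ∫ ω, ‖Mo.g j v ω‖ ^ 2)
      + ∫ ω, ∑ i, ‖v ω i‖ ^ 2)

/-- The coherent-decoding conditional SINR given the σ-algebra `m` (generated by the decoder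
side information), with the convention `0/0 = 0`. -/
def SINR_coh (Mo : DistUplinkModel Ω K N L 𝓢) (m : MeasurableSpace Ω) (k : Fin K)
    (v : Ω → Fin L × Fin N → ℂ) (ω : Ω) : ℝ :=
  ‖(ℙ[Mo.g k v | m]) ω‖ ^ 2 /
    (((ℙ[fun ω' => ‖Mo.g k v ω'‖ ^ 2 | m]) ω - ‖(ℙ[Mo.g k v | m]) ω‖ ^ 2)
      + (∑ j ∈ Finset.univ.erase k, (ℙ[fun ω' => ‖Mo.g j v ω'‖ ^ 2 | m]) ω)
      + (ℙ[fun ω' => ∑ i, ‖v ω' i‖ ^ 2 | m]) ω)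

/-- The information-constrained beamforming set `𝒱_k`: for `l` in the serving cluster `Lk`,
the block `v_l` is `σ(S_l)`-measurable with `E[‖v_l‖⁴] < ∞`, and `v_l = 0` a.s. otherwise. -/
def Vset (Mo : DistUplinkModel Ω K N L 𝓢) (Lk : Finset (Fin L)) :
    Set (Ω → Fin L × Fin N → ℂ) :=
  { v | (∀ l ∈ Lk,
          Measurable[Mo.mS l] (fun ω (n : Fin N) => v ω (l, n)) ∧
          Integrable (fun ω => (∑ n, ‖v ω (l, n)‖ ^ 2) ^ 2)) ∧
        ∀ l ∉ Lk, ∀ᵐ ω, ∀ n, v ω (l, n) = 0 }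

end DistUplinkModel

namespace DistUplinkModel

variable {Ω : Type*} [MeasureSpace Ω] {K N L : ℕ} {𝓢 : Fin L → Type*}
  [∀ l, MeasurableSpace (𝓢 l)]

/-- The local channel block `H_l` (an `N × K` matrix). -/
def Hblk (Mo : DistUplinkModel Ω K N L 𝓢) (l : Fin L) (ω : Ω) : Matrix (Fin N) (Fin K) ℂ :=
  Matrix.of fun n j => Mo.H ω (l, n) j

/-- The diagonal power matrix `P = diag(p_1, …, p_K)` (as a complex matrix). -/
def Pmat (Mo : DistUplinkModel Ω K N L 𝓢) (ω : Ω) : Matrix (Fin K) (Fin K) ℂ :=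
  Matrix.diagonal fun j => (Mo.p ω j : ℂ)

/-- The diagonal matrix `P^{1/2} = diag(√p_1, …, √p_K)`. -/
def Psqrt (Mo : DistUplinkModel Ω K N L 𝓢) (ω : Ω) : Matrix (Fin K) (Fin K) ℂ :=
  Matrix.diagonal fun j => (Real.sqrt (Mo.p ω j) : ℂ)

/-- The team-MMSE stationarity conditions: for every `l` in the serving cluster, almost surely
`v_l = (E[H_l P H_lᴴ | σ(S_l)] + I_N)⁻¹
  (E[H_l | σ(S_l)] P^{1/2} e_k − ∑_{j ∈ Lk∖{l}} E[H_l P H_jᴴ v_j | σ(S_l)])`. -/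
def OptCond (Mo : DistUplinkModel Ω K N L 𝓢) (Lk : Finset (Fin L)) (k : Fin K)
    (v : Ω → Fin L × Fin N → ℂ) : Prop :=
  ∀ l ∈ Lk, ∀ᵐ ω,
    (fun n => v ω (l, n)) =
      (Matrix.of (fun n n' =>
          (ℙ[fun ω' => (Mo.Hblk l ω' * Mo.Pmat ω' * (Mo.Hblk l ω')ᴴ) n n' | Mo.mS l]) ω)
        + 1)⁻¹ *ᵥ
      (Matrix.of (fun n j => (ℙ[fun ω' => Mo.H ω' (l, n) j | Mo.mS l]) ω) *ᵥ
          (Mo.Psqrt ω *ᵥ Pi.single k (1 : ℂ))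
        - ∑ j ∈ Lk.erase l, fun n =>
            (ℙ[fun ω' => ((Mo.Hblk l ω' * Mo.Pmat ω' * (Mo.Hblk j ω')ᴴ) *ᵥ
                fun n' => v ω' (j, n')) n | Mo.mS l]) ω)

end DistUplinkModel

set_option linter.unusedVariables false

instance holder442 : ENNReal.HolderTriple 4 4 2 where
  inv_add_inv_eq_inv := by
    rw [← ENNReal.toReal_eq_toReal_iff' (by simp) (by simp), ENNReal.toReal_add (by simp) (by simp)]
    simp [ENNReal.toReal_inv]; norm_num

theorem aux_orth {Ω ι : Type*} [Fintype ι] [DecidableEq ι] {Y T m0 : MeasurableSpace Ω}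
    {μ : Measure Ω} [IsProbabilityMeasure μ] (hY : Y ≤ m0) (hT : T ≤ m0) (hi : Indep T Y μ)
    (y a : ι → Ω → ℂ) (hy : ∀ s, Measurable[Y] (y s)) (hy2 : ∀ s, MemLp (y s) 2 μ)
    (hyo : ∀ s t, ∫ ω, y s ω * conj (y t ω) ∂μ = if s = t then 1 else 0)
    (ha : ∀ s, AEStronglyMeasurable[T] (a s) μ) (ha2 : ∀ s, MemLp (a s) 2 μ) :
    ∫ ω, ‖∑ s, a s ω * y s ω‖ ^ 2 ∂μ = ∫ ω, ∑ s, ‖a s ω‖ ^ 2 ∂μ := by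
  have hcy : ∀ s, MemLp (fun ω => conj (y s ω)) 2 μ := fun s => (hy2 s).star
  have hca : ∀ s, MemLp (fun ω => conj (a s ω)) 2 μ := fun s => (ha2 s).star
  have hyy : ∀ s t, Integrable (fun ω => y s ω * conj (y t ω)) μ := fun s t =>
    (hy2 s).integrable_mul (hcy t)
  have haa : ∀ s t, Integrable (fun ω => a s ω * conj (a t ω)) μ := fun s t =>
    (ha2 s).integrable_mul (hca t)
  have hind : ∀ s t, IndepFun (fun ω => a s ω * conj (a t ω)) (fun ω => y s ω * conj (y t ω)) μ := by
    intro s t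
    have h1 : IndepFun (fun ω => (ha s).mk _ ω * conj ((ha t).mk _ ω))
        (fun ω => y s ω * conj (y t ω)) μ := by
      rw [IndepFun_iff_Indep]
      refine indep_of_indep_of_le_left (indep_of_indep_of_le_right hi ?_) ?_
      · rw [← measurable_iff_comap_le]
        exact (hy s).mul (Complex.continuous_conj.measurable.comp (hy t))
      · rw [← measurable_iff_comap_le]
        exact ((ha s).stronglyMeasurable_mk.measurable).mul
          (Complex.continuous_conj.measurable.comp (ha t).stronglyMeasurable_mk.measurable)
    refine h1.congr ?_ (Filter.EventuallyEq.refl _ _)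
    filter_upwards [(ha s).ae_eq_mk, (ha t).ae_eq_mk] with ω h1 h2
    rw [← h1, ← h2]
  have hint : ∀ s t, Integrable (fun ω => (a s ω * conj (a t ω)) * (y s ω * conj (y t ω))) μ :=
    fun s t => (hind s t).integrable_mul (haa s t) (hyy s t)
  have hval : ∀ s t, ∫ ω, (a s ω * conj (a t ω)) * (y s ω * conj (y t ω)) ∂μ
      = if s = t then ∫ ω, a s ω * conj (a s ω) ∂μ else 0 := by
    intro s t
    rw [(hind s t).integral_fun_mul_eq_mul_integral (haa s t).1 (hyy s t).1, hyo]
    split_ifs with h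
    · subst h; simp
    · simp
  have hexp : ∀ ω, ((‖∑ s, a s ω * y s ω‖ ^ 2 : ℝ) : ℂ)
      = ∑ s, ∑ t, (a s ω * conj (a t ω)) * (y s ω * conj (y t ω)) := by
    intro ω
    rw [Complex.ofReal_pow, ← Complex.mul_conj', map_sum, Finset.sum_mul_sum]
    refine Finset.sum_congr rfl fun s _ => Finset.sum_congr rfl fun t _ => ?_
    rw [map_mul]; ring
  have : ((∫ ω, ‖∑ s, a s ω * y s ω‖ ^ 2 ∂μ : ℝ) : ℂ) = ((∫ ω, ∑ s, ‖a s ω‖ ^ 2 ∂μ : ℝ) : ℂ) := by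
    rw [← integral_complex_ofReal, ← integral_complex_ofReal]
    simp_rw [hexp]
    rw [integral_finsetSum _ fun s _ => integrable_finsetSum _ fun t _ => hint s t]
    simp_rw [Complex.ofReal_sum, Complex.ofReal_pow, ← Complex.mul_conj']
    rw [integral_finsetSum _ fun s _ => haa s s]
    refine Finset.sum_congr rfl fun s _ => ?_
    rw [integral_finsetSum _ fun t _ => hint s t]
    simp [hval]
  exact_mod_cast this

theorem aux_aesm_sum {Ω ι : Type*} {m m0 : MeasurableSpace Ω} {μ : Measure Ω}
    (s : Finset ι) (f : ι → Ω → ℂ) (h : ∀ i, AEStronglyMeasurable[m] (f i) μ) :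
    AEStronglyMeasurable[m] (fun ω => ∑ i ∈ s, f i ω) μ := by
  classical
  induction s using Finset.induction_on with
  | empty => simpa using aestronglyMeasurable_const
  | insert a s ha ih =>
    simp only [Finset.sum_insert ha]
    exact (h a).add ih

theorem aux_pull {Ω : Type*} {m m0 : MeasurableSpace Ω} {μ : Measure Ω}
    {c f : Ω → ℂ} (hc : AEStronglyMeasurable[m] c μ) (hcf : Integrable (fun ω => c ω * f ω) μ)
    (hf : Integrable f μ) :
    μ[fun ω => c ω * f ω | m] =ᵐ[μ] fun ω => c ω * (μ[f | m]) ω :=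
  condExp_bilin_of_aestronglyMeasurable_left (ContinuousLinearMap.mul ℝ ℂ) hc hcf hf

theorem aux_pull_sum {Ω ι : Type*} {m m0 : MeasurableSpace Ω} {μ : Measure Ω}
    (s : Finset ι) {c f : ι → Ω → ℂ} (hc : ∀ i ∈ s, AEStronglyMeasurable[m] (c i) μ)
    (hcf : ∀ i ∈ s, Integrable (fun ω => c i ω * f i ω) μ)
    (hf : ∀ i ∈ s, Integrable (f i) μ) :
    μ[fun ω => ∑ i ∈ s, c i ω * f i ω | m] =ᵐ[μ] fun ω => ∑ i ∈ s, c i ω * (μ[f i | m]) ω := by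
  have h1 := condExp_finsetSum (m := m) (f := fun i ω => c i ω * f i ω) hcf
  have h2 : ∀ᵐ ω ∂μ, ∀ i ∈ s, (μ[fun ω => c i ω * f i ω | m]) ω = c i ω * (μ[f i | m]) ω := by
    rw [Finset.eventually_all]
    exact fun i hi => aux_pull (hc i hi) (hcf i hi) (hf i hi)
  have e : (∑ i ∈ s, fun ω => c i ω * f i ω) = fun ω => ∑ i ∈ s, c i ω * f i ω := by
    ext ω; simp
  rw [e] at h1
  filter_upwards [h1, h2] with ω a b
  rw [a, Finset.sum_apply]
  exact Finset.sum_congr rfl b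

theorem aux_psd {Ω : Type*} {N K : ℕ} {m m0 : MeasurableSpace Ω} {μ : Measure Ω}
    [IsProbabilityMeasure μ] (G : Fin N → Fin K → Ω → ℂ)
    (hG : ∀ n n', Integrable (fun ω => ∑ j, G n j ω * conj (G n' j ω)) μ) :
    ∀ᵐ ω ∂μ, ∀ x : Fin N → ℂ, 0 ≤ (∑ n, conj (x n) * ∑ n',
      (μ[fun ω => ∑ j, G n j ω * conj (G n' j ω) | m]) ω * x n').re := by
  have key : ∀ x : Fin N → ℂ, ∀ᵐ ω ∂μ, 0 ≤ (∑ n, conj (x n) * ∑ n',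
      (μ[fun ω => ∑ j, G n j ω * conj (G n' j ω) | m]) ω * x n').re := by
    intro x
    let c : Fin N × Fin N → Ω → ℂ := fun q _ => conj (x q.1) * x q.2
    let f : Fin N × Fin N → Ω → ℂ := fun q ω => ∑ j, G q.1 j ω * conj (G q.2 j ω)
    have hint : ∀ q, Integrable (fun ω => c q ω * f q ω) μ := fun q => (hG q.1 q.2).const_mul _
    have h1 := aux_pull_sum (m := m) (μ := μ) Finset.univ (c := c) (f := f)
      (fun q _ => aestronglyMeasurable_const) (fun q _ => hint q) (fun q _ => hG q.1 q.2)
    have h2 := Complex.reCLM.comp_condExp_comm (m := m)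
      (integrable_finsetSum (μ := μ) (Finset.univ) fun q _ => hint q)
    have h3 : 0 ≤ᵐ[μ] μ[Complex.reCLM ∘ (fun ω => ∑ q, c q ω * f q ω) | m] := by
      refine condExp_nonneg (Filter.Eventually.of_forall fun ω => ?_)
      have e : ∑ q, c q ω * f q ω = ((∑ j, ‖∑ n, conj (x n) * G n j ω‖ ^ 2 : ℝ) : ℂ) := by
        simp only [c, f, Complex.ofReal_sum, Complex.ofReal_pow, ← Complex.mul_conj', map_sum,
          map_mul, Complex.conj_conj, Finset.sum_mul_sum, Fintype.sum_prod_type]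
        conv_rhs => rw [Finset.sum_comm]
        refine Finset.sum_congr rfl fun n _ => ?_
        conv_rhs => rw [Finset.sum_comm]
        refine Finset.sum_congr rfl fun n' _ => ?_
        rw [Finset.mul_sum]
        refine Finset.sum_congr rfl fun j _ => ?_
        ring
      simp only [Function.comp, Pi.zero_apply, e, Complex.reCLM_apply, Complex.ofReal_re]
      positivity
    filter_upwards [h1, h2, h3] with ω a b d
    rw [← b] at d
    simp only [Function.comp, Pi.zero_apply, Complex.reCLM_apply, a] at d
    convert d using 2
    simp only [Fintype.sum_prod_type, Finset.mul_sum]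
    refine Finset.sum_congr rfl fun n _ => Finset.sum_congr rfl fun n' _ => ?_
    simp only [c, f]
    ring
  have hall := ae_all_iff.2 fun i : ℕ => key (TopologicalSpace.denseSeq (Fin N → ℂ) i)
  filter_upwards [hall] with ω h x
  refine (TopologicalSpace.denseRange_denseSeq (Fin N → ℂ)).induction_on
    (p := fun x => 0 ≤ (∑ n, conj (x n) * ∑ n',
      (μ[fun ω => ∑ j, G n j ω * conj (G n' j ω) | m]) ω * x n').re) x ?_ h
  refine isClosed_le continuous_const ?_
  refine Complex.continuous_re.comp (continuous_finsetSum _ fun n _ => ?_)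
  refine (Complex.continuous_conj.comp (continuous_apply n)).mul
    (continuous_finsetSum _ fun n' _ => continuous_const.mul (continuous_apply n'))

theorem aux_unit {N : ℕ} (A : Matrix (Fin N) (Fin N) ℂ)
    (h : ∀ x : Fin N → ℂ, 0 ≤ (∑ n, conj (x n) * ∑ n', A n n' * x n').re) : IsUnit (A + 1) := by
  rw [← Matrix.mulVec_injective_iff_isUnit]
  rw [← Matrix.coe_mulVecLin, ← LinearMap.ker_eq_bot, LinearMap.ker_eq_bot']
  intro x hx
  have h1 : ∀ n, ∑ n', A n n' * x n' = - x n := by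
    intro n
    have := congrFun hx n
    simp only [Matrix.coe_mulVecLin, Matrix.add_mulVec, Matrix.one_mulVec, Pi.add_apply,
      Pi.zero_apply] at this
    exact eq_neg_of_add_eq_zero_left this
  have h2 := h x
  simp_rw [h1] at h2
  have h3 : (∑ n, conj (x n) * - x n).re = - ∑ n, ‖x n‖ ^ 2 := by
    rw [Complex.re_sum, ← Finset.sum_neg_distrib]
    refine Finset.sum_congr rfl fun n _ => ?_
    rw [mul_neg, Complex.conj_mul', Complex.neg_re, ← Complex.ofReal_pow, Complex.ofReal_re]
  rw [h3] at h2
  have h4 : ∑ n, ‖x n‖ ^ 2 = 0 := le_antisymm (by linarith) (by positivity)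
  rw [Finset.sum_eq_zero_iff_of_nonneg (fun _ _ => by positivity)] at h4
  ext n
  simpa using h4 n (mem_univ n)

theorem aux_solve {N : ℕ} (A : Matrix (Fin N) (Fin N) ℂ) (h : IsUnit (A + 1)) (v b : Fin N → ℂ) :
    v = (A + 1)⁻¹ *ᵥ b ↔ (A + 1) *ᵥ v = b := by
  have hd : IsUnit (A + 1).det := (Matrix.isUnit_iff_isUnit_det _).1 h
  constructor
  · rintro rfl
    rw [Matrix.mulVec_mulVec, Matrix.mul_nonsing_inv _ hd, Matrix.one_mulVec]
  · rintro rfl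
    rw [Matrix.mulVec_mulVec, Matrix.nonsing_inv_mul _ hd, Matrix.one_mulVec]

theorem aux_L4 {Ω ι : Type*} [Fintype ι] {m0 : MeasurableSpace Ω} {μ : Measure Ω}
    (f : ι → Ω → ℂ) (h : ∀ i, MemLp (f i) 4 μ) :
    Integrable (fun ω => (∑ i, ‖f i ω‖ ^ 2) ^ 2) μ := by
  have h1 : ∀ i, MemLp (fun ω => ‖f i ω‖ ^ 2) 2 μ := by
    intro i
    have : MemLp (fun ω => ‖f i ω‖ * ‖f i ω‖) 2 μ := (h i).norm.mul (h i).norm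
    simpa [sq] using this
  have h2 : MemLp (fun ω => ∑ i, ‖f i ω‖ ^ 2) 2 μ := memLp_finsetSum _ fun i _ => h1 i
  exact h2.integrable_sq

theorem aux_L4' {Ω ι : Type*} [Fintype ι] {m0 : MeasurableSpace Ω} {μ : Measure Ω}
    (f : ι → Ω → ℂ) (hm : ∀ i, AEStronglyMeasurable (f i) μ)
    (h : Integrable (fun ω => (∑ i, ‖f i ω‖ ^ 2) ^ 2) μ) (i) : MemLp (f i) 4 μ := by
  rw [← integrable_norm_rpow_iff (hm i) (by simp) (by simp)]
  refine h.mono' ((hm i).norm.aemeasurable.pow_const _).aestronglyMeasurable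
    (Filter.Eventually.of_forall fun ω => ?_)
  have e1 : ‖f i ω‖ ^ 2 ≤ ∑ j, ‖f j ω‖ ^ 2 :=
    Finset.single_le_sum (f := fun j => ‖f j ω‖ ^ 2) (fun _ _ => by positivity) (mem_univ i)
  rw [Real.norm_of_nonneg (by positivity)]
  have : ‖f i ω‖ ^ (4 : ℝ≥0∞).toReal = (‖f i ω‖ ^ 2) ^ 2 := by
    rw [← pow_mul]; norm_num
  rw [this]
  gcongr

set_option linter.unusedSectionVars false
set_option linter.unusedVariables false

namespace DistUplinkModel

variable {Ω : Type*} [MeasureSpace Ω] {K N L : ℕ} {𝓢 : Fin L → Type*}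
  [∀ l, MeasurableSpace (𝓢 l)]

/-- effective channel -/
def G (Mo : DistUplinkModel Ω K N L 𝓢) (i : Fin L × Fin N) (j : Fin K) (ω : Ω) : ℂ :=
  (Real.sqrt (Mo.p ω j) : ℂ) * Mo.H ω i j

def mT (Mo : DistUplinkModel Ω K N L 𝓢) : MeasurableSpace Ω :=
  MeasurableSpace.comap (fun ω => (Mo.H ω, fun l => Mo.S l ω)) inferInstance

def mX (Mo : DistUplinkModel Ω K N L 𝓢) (i : Fin K ⊕ Bool) : MeasurableSpace Ω :=
  Sum.elim (fun j => MeasurableSpace.comap (Mo.x j) inferInstance)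
      (fun b => if b then
          MeasurableSpace.comap (fun ω => (Mo.H ω, fun l => Mo.S l ω)) inferInstance
        else MeasurableSpace.comap Mo.z inferInstance) i

theorem mT_le (Mo : DistUplinkModel Ω K N L 𝓢) : Mo.mT ≤ (inferInstance : MeasurableSpace Ω) :=
  (Mo.hH_meas.prodMk (measurable_pi_lambda _ Mo.hS_meas)).comap_le

theorem mX_le (Mo : DistUplinkModel Ω K N L 𝓢) (i) :
    Mo.mX i ≤ (inferInstance : MeasurableSpace Ω) := by
  rcases i with j | b
  · exact (Mo.hx_meas j).comap_le
  · cases b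
    · exact Mo.hz_meas.comap_le
    · exact Mo.mT_le

theorem mS_le (Mo : DistUplinkModel Ω K N L 𝓢) (l) :
    Mo.mS l ≤ (inferInstance : MeasurableSpace Ω) := (Mo.hS_meas l).comap_le

theorem mS_le_mT (Mo : DistUplinkModel Ω K N L 𝓢) (l) : Mo.mS l ≤ Mo.mT := by
  have h : Measurable[Mo.mT] (fun ω => (Mo.H ω, fun l => Mo.S l ω)) := comap_measurable _
  exact ((measurable_pi_apply l).comp (measurable_snd.comp h)).comap_le

theorem p_meas_mT (Mo : DistUplinkModel Ω K N L 𝓢) : Measurable[Mo.mT] Mo.p := by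
  have h : Measurable[Mo.mT] (fun ω => (Mo.H ω, fun l => Mo.S l ω)) := comap_measurable _
  exact Mo.hp_meas.mono (measurable_snd.comp h).comap_le le_rfl

theorem H_meas_mT (Mo : DistUplinkModel Ω K N L 𝓢) : Measurable[Mo.mT] Mo.H := by
  have h : Measurable[Mo.mT] (fun ω => (Mo.H ω, fun l => Mo.S l ω)) := comap_measurable _
  exact (measurable_fst.comp h)

theorem G_meas_mT (Mo : DistUplinkModel Ω K N L 𝓢) (i j) : Measurable[Mo.mT] (Mo.G i j) := by
  refine Measurable.mul ?_ ?_
  · exact Complex.measurable_ofReal.comp (Real.continuous_sqrt.measurable.comp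
      ((measurable_pi_apply j).comp Mo.p_meas_mT))
  · exact (measurable_pi_apply j).comp ((measurable_pi_apply i).comp Mo.H_meas_mT)

theorem H_L4 (Mo : DistUplinkModel Ω K N L 𝓢) (i j) : MemLp (fun ω => Mo.H ω i j) 4 ℙ := by
  have hm : Measurable (fun ω => Mo.H ω i j) :=
    (measurable_pi_apply j).comp ((measurable_pi_apply i).comp Mo.hH_meas)
  rw [← integrable_norm_rpow_iff hm.aestronglyMeasurable (by simp) (by simp)]
  refine Mo.hHHherm_L2.mono' (hm.norm.pow_const _).aestronglyMeasurable
    (Filter.Eventually.of_forall fun ω => ?_)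
  have e : (Matrix.of (Mo.H ω) * (Matrix.of (Mo.H ω))ᴴ) i i
      = ((∑ j, ‖Mo.H ω i j‖ ^ 2 : ℝ) : ℂ) := by
    simp [Matrix.mul_apply, Complex.mul_conj']
  have e1 : ‖Mo.H ω i j‖ ^ 2 ≤ ∑ j, ‖Mo.H ω i j‖ ^ 2 :=
    Finset.single_le_sum (f := fun j => ‖Mo.H ω i j‖ ^ 2) (fun _ _ => by positivity) (mem_univ j)
  have e2 : ‖(Matrix.of (Mo.H ω) * (Matrix.of (Mo.H ω))ᴴ) i i‖ ^ 2 ≤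
      ∑ i, ∑ i', ‖(Matrix.of (Mo.H ω) * (Matrix.of (Mo.H ω))ᴴ) i i'‖ ^ 2 := by
    refine le_trans ?_ (Finset.single_le_sum
      (f := fun i => ∑ i', ‖(Matrix.of (Mo.H ω) * (Matrix.of (Mo.H ω))ᴴ) i i'‖ ^ 2)
      (fun _ _ => by positivity) (mem_univ i))
    exact (Finset.single_le_sum
      (f := fun i' => ‖(Matrix.of (Mo.H ω) * (Matrix.of (Mo.H ω))ᴴ) i i'‖ ^ 2)
      (fun _ _ => by positivity) (mem_univ i))
  refine le_trans ?_ e2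
  rw [e, Complex.norm_real, Real.norm_of_nonneg (by positivity), Real.norm_of_nonneg (by positivity)]
  have : ‖Mo.H ω i j‖ ^ (4 : ℝ≥0∞).toReal = (‖Mo.H ω i j‖ ^ 2) ^ 2 := by
    rw [← pow_mul]; norm_num
  rw [this]
  gcongr

theorem psqrt_top (Mo : DistUplinkModel Ω K N L 𝓢) (j) :
    MemLp (fun ω => (Real.sqrt (Mo.p ω j) : ℂ)) ∞ ℙ := by
  obtain ⟨C, hC⟩ := Mo.hp_bdd
  have : Measurable (fun ω => (Real.sqrt (Mo.p ω j) : ℂ)) :=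
    Complex.measurable_ofReal.comp (Real.continuous_sqrt.measurable.comp
      ((measurable_pi_apply j).comp (Mo.p_meas_mT.mono Mo.mT_le le_rfl)))
  refine memLp_top_of_bound this.aestronglyMeasurable (Real.sqrt C) ?_
  filter_upwards [hC] with ω h
  rw [Complex.norm_real, Real.norm_of_nonneg (by positivity)]
  exact Real.sqrt_le_sqrt (h j)

theorem G_L4 (Mo : DistUplinkModel Ω K N L 𝓢) (i j) : MemLp (Mo.G i j) 4 ℙ :=
  (Mo.H_L4 i j).mul (Mo.psqrt_top j)

variable [IsProbabilityMeasure (ℙ : Measure Ω)]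

def yv (Mo : DistUplinkModel Ω K N L 𝓢) (s : Fin K ⊕ (Fin L × Fin N)) : Ω → ℂ :=
  Sum.elim Mo.x (fun i ω => Mo.z ω i) s

def mY (Mo : DistUplinkModel Ω K N L 𝓢) : MeasurableSpace Ω :=
  ⨆ i ∈ ({Sum.inr true}ᶜ : Set (Fin K ⊕ Bool)), Mo.mX i

theorem mY_le (Mo : DistUplinkModel Ω K N L 𝓢) : Mo.mY ≤ (inferInstance : MeasurableSpace Ω) :=
  iSup₂_le fun i _ => Mo.mX_le i

theorem indep_TY (Mo : DistUplinkModel Ω K N L 𝓢) : Indep Mo.mT Mo.mY ℙ := by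
  have h := indep_iSup_of_disjoint (m := Mo.mX) (μ := ℙ) Mo.mX_le Mo.hindep
    (S := {Sum.inr true}) (T := {Sum.inr true}ᶜ) disjoint_compl_right
  refine indep_of_indep_of_le_left h ?_
  exact le_iSup₂_of_le (Sum.inr true) rfl le_rfl

theorem yv_meas (Mo : DistUplinkModel Ω K N L 𝓢) (s) : Measurable[Mo.mY] (Mo.yv s) := by
  rcases s with j | i
  · have h : Mo.mX (Sum.inl j) ≤ Mo.mY := le_iSup₂_of_le (Sum.inl j) (by simp) le_rfl
    exact (comap_measurable (Mo.x j)).mono h le_rfl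
  · have h : Mo.mX (Sum.inr false) ≤ Mo.mY := le_iSup₂_of_le (Sum.inr false) (by simp) le_rfl
    exact (measurable_pi_apply i).comp ((comap_measurable (Mo.z)).mono h le_rfl)

theorem yv_L2 (Mo : DistUplinkModel Ω K N L 𝓢) (s) : MemLp (Mo.yv s) 2 ℙ := by
  rcases s with j | i
  · exact Mo.hx_L2 j
  · exact Mo.hz_L2 i

theorem indep_zero {Ω : Type*} {m1 m2 m0 : MeasurableSpace Ω} {μ : Measure Ω} [IsProbabilityMeasure μ]
    {X Y : Ω → ℂ} (h : Indep m1 m2 μ)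
    (hX : Measurable[m1] X) (hY : Measurable[m2] Y) (hX1 : AEStronglyMeasurable X μ)
    (hY1 : AEStronglyMeasurable Y μ) (h0 : ∫ ω, X ω ∂μ = 0) :
    ∫ ω, X ω * conj (Y ω) ∂μ = 0 := by
  have : IndepFun X (fun ω => conj (Y ω)) μ := by
    rw [IndepFun_iff_Indep]
    refine indep_of_indep_of_le_left (indep_of_indep_of_le_right h ?_) ?_
    · rw [← measurable_iff_comap_le]
      exact (Complex.continuous_conj.measurable.comp hY)
    · rw [← measurable_iff_comap_le]
      exact hX
  rw [this.integral_fun_mul_eq_mul_integral hX1 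
    (Complex.continuous_conj.comp_aestronglyMeasurable hY1), h0, zero_mul]

theorem yv_orth (Mo : DistUplinkModel Ω K N L 𝓢) (s t) :
    ∫ ω, Mo.yv s ω * conj (Mo.yv t ω) = if s = t then 1 else 0 := by
  have hz : ∀ i, Measurable[Mo.mX (Sum.inr false)] (fun ω => Mo.z ω i) := fun i =>
    (measurable_pi_apply i).comp (comap_measurable (Mo.z))
  have hx : ∀ j, Measurable[Mo.mX (Sum.inl j)] (Mo.x j) := fun j => comap_measurable _
  have hI : ∀ a b, a ≠ b → Indep (Mo.mX a) (Mo.mX b) ℙ := fun a b h => Mo.hindep.indep h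
  rcases s with j | i <;> rcases t with j' | i'
  · by_cases h : j = j'
    · subst h
      simp only [yv, Sum.elim_inl, if_true, Complex.mul_conj']
      have := Mo.hx_var j
      have h2 : ((∫ ω, ‖Mo.x j ω‖ ^ 2 : ℝ) : ℂ) = 1 := by rw [this]; simp
      rw [← integral_complex_ofReal] at h2
      simpa using h2
    · rw [if_neg (by simpa using h)]
      exact indep_zero (hI _ _ (by simpa using h)) (hx j) (hx j') (Mo.hx_L2 j).1 (Mo.hx_L2 j').1
        (Mo.hx_mean j)
  · rw [if_neg (by simp)]
    exact indep_zero (hI _ _ (by simp)) (hx j) (hz i') (Mo.hx_L2 j).1 (Mo.hz_L2 i').1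
        (Mo.hx_mean j)
  · rw [if_neg (by simp)]
    exact indep_zero (hI _ _ (by simp)) (hz i) (hx j') (Mo.hz_L2 i).1 (Mo.hx_L2 j').1
        (Mo.hz_mean i)
  · simpa [yv] using Mo.hz_cov i i'

/-- good beamformers -/
def Good (Mo : DistUplinkModel Ω K N L 𝓢) (v : Ω → Fin L × Fin N → ℂ) : Prop :=
  ∀ i, MemLp (fun ω => v ω i) 4 ℙ ∧ AEStronglyMeasurable[Mo.mT] (fun ω => v ω i) ℙ

/-- linear part of the error coefficients -/
def Fc (Mo : DistUplinkModel Ω K N L 𝓢) (v : Ω → Fin L × Fin N → ℂ)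
    (s : Fin K ⊕ (Fin L × Fin N)) (ω : Ω) : ℂ :=
  Sum.elim (fun j => - ∑ i, Mo.G i j ω * conj (v ω i)) (fun i => - conj (v ω i)) s

def Ec (Mo : DistUplinkModel Ω K N L 𝓢) (k : Fin K) (v : Ω → Fin L × Fin N → ℂ)
    (s : Fin K ⊕ (Fin L × Fin N)) (ω : Ω) : ℂ :=
  (if s = Sum.inl k then 1 else 0) + Mo.Fc v s ω

theorem err_eq (Mo : DistUplinkModel Ω K N L 𝓢) (k : Fin K) (v : Ω → Fin L × Fin N → ℂ) (ω : Ω) :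
    Mo.x k ω - ∑ i, conj (v ω i) * Mo.r ω i = ∑ s, Mo.Ec k v s ω * Mo.yv s ω := by
  simp only [Ec, add_mul, Finset.sum_add_distrib, ite_mul, one_mul, zero_mul, Finset.sum_ite_eq',
    Finset.mem_univ, if_true]
  simp only [Fintype.sum_sum_type, Fc, yv, Sum.elim_inl, Sum.elim_inr, r, mul_add,
    Finset.sum_add_distrib, neg_mul, Finset.sum_neg_distrib, Finset.mul_sum, Finset.sum_mul]
  rw [Finset.sum_comm]
  simp only [G]
  have : ∀ (i : Fin L × Fin N) (j : Fin K), conj (v ω i) * ((Real.sqrt (Mo.p ω j) : ℂ) * Mo.H ω i j * Mo.x j ω)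
    = (Real.sqrt (Mo.p ω j) : ℂ) * Mo.H ω i j * conj (v ω i) * Mo.x j ω := fun i j => by ring
  simp only [this]
  ring

theorem Fc_good (Mo : DistUplinkModel Ω K N L 𝓢) {v : Ω → Fin L × Fin N → ℂ} (hv : Mo.Good v) (s) :
    MemLp (Mo.Fc v s) 2 ℙ ∧ AEStronglyMeasurable[Mo.mT] (Mo.Fc v s) ℙ := by
  have hc : ∀ i, AEStronglyMeasurable[Mo.mT] (fun ω => conj (v ω i)) ℙ := fun i =>
    Complex.continuous_conj.comp_aestronglyMeasurable (hv i).2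
  rcases s with j | i
  · constructor
    · refine MemLp.neg ?_
      refine memLp_finsetSum _ fun i _ => ?_
      exact (hv i).1.star.mul (Mo.G_L4 i j)
    · have h1 : ∀ i, AEStronglyMeasurable[Mo.mT] (fun ω => Mo.G i j ω * conj (v ω i)) ℙ := fun i =>
        ((Mo.G_meas_mT i j).stronglyMeasurable.aestronglyMeasurable).mul (hc i)
      have h2 : AEStronglyMeasurable[Mo.mT] (fun ω => ∑ i, Mo.G i j ω * conj (v ω i)) ℙ :=
        aux_aesm_sum _ _ h1
      exact h2.neg
  · exact ⟨((hv i).1.star.mono_exponent (by norm_num)).neg, (hc i).neg⟩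

theorem Ec_good (Mo : DistUplinkModel Ω K N L 𝓢) (k) {v : Ω → Fin L × Fin N → ℂ} (hv : Mo.Good v) (s) :
    MemLp (Mo.Ec k v s) 2 ℙ ∧ AEStronglyMeasurable[Mo.mT] (Mo.Ec k v s) ℙ :=
  by
  have h1 : MemLp (fun _ : Ω => if s = Sum.inl k then (1 : ℂ) else 0) 2 ℙ := memLp_const _
  have h2 : AEStronglyMeasurable[Mo.mT] (fun _ : Ω => if s = Sum.inl k then (1 : ℂ) else 0) ℙ :=
    aestronglyMeasurable_const
  exact ⟨h1.add (Mo.Fc_good hv s).1, h2.add (Mo.Fc_good hv s).2⟩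

theorem MSE_eq (Mo : DistUplinkModel Ω K N L 𝓢) (k) {v : Ω → Fin L × Fin N → ℂ} (hv : Mo.Good v) :
    Mo.MSE k v = ∫ ω, ∑ s, ‖Mo.Ec k v s ω‖ ^ 2 := by
  unfold MSE
  simp_rw [err_eq]
  exact aux_orth Mo.mY_le Mo.mT_le Mo.indep_TY Mo.yv (Mo.Ec k v) Mo.yv_meas Mo.yv_L2 Mo.yv_orth
    (fun s => (Mo.Ec_good k hv s).2) (fun s => (Mo.Ec_good k hv s).1)

/-- residual -/
def Rs (Mo : DistUplinkModel Ω K N L 𝓢) (k : Fin K) (v : Ω → Fin L × Fin N → ℂ)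
    (i : Fin L × Fin N) (ω : Ω) : ℂ :=
  v ω i - Mo.G i k ω + ∑ i', (∑ j, Mo.G i j ω * conj (Mo.G i' j ω)) * v ω i'

theorem cross (Mo : DistUplinkModel Ω K N L 𝓢) (k : Fin K) (v w : Ω → Fin L × Fin N → ℂ) (ω : Ω) :
    ∑ s, conj (Mo.Ec k v s ω) * Mo.Fc w s ω = ∑ i, conj (w ω i) * Mo.Rs k v i ω := by
  simp only [Ec, add_mul, Finset.sum_add_distrib, map_add, apply_ite conj, map_one, map_zero,
    ite_mul, one_mul, zero_mul, Finset.sum_ite_eq', Finset.mem_univ, if_true]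
  simp only [Fintype.sum_sum_type, Fc, Sum.elim_inl, Sum.elim_inr, map_neg, neg_mul_neg,
    Complex.conj_conj, Rs, mul_add, mul_sub, Finset.sum_add_distrib, Finset.sum_sub_distrib]
  have h1 : ∑ j, conj (∑ i, Mo.G i j ω * conj (v ω i)) * ∑ i, Mo.G i j ω * conj (w ω i)
      = ∑ i, conj (w ω i) * ∑ i', (∑ j, Mo.G i j ω * conj (Mo.G i' j ω)) * v ω i' := by
    simp only [map_sum, Finset.sum_mul, Finset.mul_sum, map_mul, Complex.conj_conj]
    rw [Finset.sum_comm]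
    refine Finset.sum_congr rfl fun i _ => ?_
    rw [Finset.sum_comm]
    refine Finset.sum_congr rfl fun i' _ => Finset.sum_congr rfl fun j _ => ?_
    ring
  rw [h1]
  simp only [mul_comm]
  ring

theorem Good.add_smul {Mo : DistUplinkModel Ω K N L 𝓢} {v w : Ω → Fin L × Fin N → ℂ}
    (hv : Mo.Good v) (hw : Mo.Good w) (t : ℂ) : Mo.Good (fun ω i => v ω i + t * w ω i) := fun i =>
  ⟨(hv i).1.add ((hw i).1.const_mul t), (hv i).2.add (aestronglyMeasurable_const.mul (hw i).2)⟩

theorem cross_int (Mo : DistUplinkModel Ω K N L 𝓢) (k : Fin K) {v w : Ω → Fin L × Fin N → ℂ}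
    (hv : Mo.Good v) (hw : Mo.Good w) :
    Integrable (fun ω => ∑ i, conj (w ω i) * Mo.Rs k v i ω) ℙ := by
  simp_rw [← cross]
  refine integrable_finsetSum _ fun s _ => ?_
  exact (Mo.Ec_good k hv s).1.star.integrable_mul (Mo.Fc_good hw s).1

def Qf (Mo : DistUplinkModel Ω K N L 𝓢) (w : Ω → Fin L × Fin N → ℂ) : ℝ :=
  ∫ ω, ∑ s, ‖Mo.Fc w s ω‖ ^ 2

theorem sq_int (a : Fin K ⊕ (Fin L × Fin N) → Ω → ℂ) (h : ∀ s, MemLp (a s) 2 ℙ) :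
    Integrable (fun ω => ∑ s, ‖a s ω‖ ^ 2) ℙ :=
  integrable_finsetSum _ fun s _ => (h s).integrable_norm_pow (by norm_num)

theorem MSE_quad (Mo : DistUplinkModel Ω K N L 𝓢) (k) {v w : Ω → Fin L × Fin N → ℂ}
    (hv : Mo.Good v) (hw : Mo.Good w) (t : ℝ) :
    Mo.MSE k (fun ω i => v ω i + (t : ℂ) * w ω i) = Mo.MSE k v
      + 2 * t * (∫ ω, ∑ i, conj (w ω i) * Mo.Rs k v i ω).re + t ^ 2 * Mo.Qf w := by
  rw [MSE_eq _ _ hv, MSE_eq _ _ (hv.add_smul hw t), Qf]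
  have hp : ∀ ω, ∑ s, ‖Mo.Ec k (fun ω i => v ω i + (t : ℂ) * w ω i) s ω‖ ^ 2
      = ∑ s, ‖Mo.Ec k v s ω‖ ^ 2 + 2 * t * (∑ i, conj (w ω i) * Mo.Rs k v i ω).re
        + t ^ 2 * ∑ s, ‖Mo.Fc w s ω‖ ^ 2 := by
    intro ω
    rw [← cross, Complex.re_sum, Finset.mul_sum, Finset.mul_sum, ← Finset.sum_add_distrib,
      ← Finset.sum_add_distrib]
    refine Finset.sum_congr rfl fun s _ => ?_
    have : Mo.Ec k (fun ω i => v ω i + (t : ℂ) * w ω i) s ω = Mo.Ec k v s ω + t * Mo.Fc w s ω := by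
      rcases s with j | i
      · simp only [Ec, Fc, Sum.elim_inl, map_add, map_mul, Complex.conj_ofReal, mul_add,
          Finset.sum_add_distrib, mul_neg, Finset.mul_sum]
        simp only [mul_left_comm]
        ring
      · simp only [Ec, Fc, Sum.elim_inr, map_add, map_mul, Complex.conj_ofReal]
        ring
    rw [this, ← Complex.normSq_eq_norm_sq, ← Complex.normSq_eq_norm_sq, ← Complex.normSq_eq_norm_sq]
    simp only [Complex.normSq_apply, Complex.add_re, Complex.add_im, Complex.mul_re, Complex.mul_im,
      Complex.conj_re, Complex.conj_im, Complex.ofReal_re, Complex.ofReal_im]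
    ring
  simp_rw [hp]
  have h1 := sq_int (Mo.Ec k v) fun s => (Mo.Ec_good k hv s).1
  have h2 := sq_int (Mo.Fc w) fun s => (Mo.Fc_good hw s).1
  have h3 := Mo.cross_int k hv hw
  have h3r : Integrable (fun ω => (∑ i, conj (w ω i) * Mo.Rs k v i ω).re) ℙ := h3.re
  have h4 : Integrable (fun ω => ∑ s, ‖Mo.Ec k v s ω‖ ^ 2
      + 2 * t * (∑ i, conj (w ω i) * Mo.Rs k v i ω).re) ℙ := h1.add (h3r.const_mul _)
  rw [integral_add h4 (h2.const_mul _), integral_add h1 (h3r.const_mul _),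
    integral_const_mul, integral_const_mul]
  congr 3
  exact integral_re h3

end DistUplinkModel

namespace DistUplinkModel

variable {Ω : Type*} [MeasureSpace Ω] {K N L : ℕ} {𝓢 : Fin L → Type*}
  [∀ l, MeasurableSpace (𝓢 l)] [IsProbabilityMeasure (ℙ : Measure Ω)]

theorem vset_meas {Mo : DistUplinkModel Ω K N L 𝓢} {Lk : Finset (Fin L)}
    {v : Ω → Fin L × Fin N → ℂ} (hv : v ∈ Mo.Vset Lk) {l} (hl : l ∈ Lk) (n : Fin N) :
    Measurable[Mo.mS l] (fun ω => v ω (l, n)) :=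
  (measurable_pi_apply n).comp (hv.1 l hl).1

theorem vset_good {Mo : DistUplinkModel Ω K N L 𝓢} {Lk : Finset (Fin L)}
    {v : Ω → Fin L × Fin N → ℂ} (hv : v ∈ Mo.Vset Lk) : Mo.Good v := by
  rintro ⟨l, n⟩
  by_cases hl : l ∈ Lk
  · have h := fun n => vset_meas hv hl n
    refine ⟨aux_L4' (fun n ω => v ω (l, n))
      (fun n => ((h n).mono (Mo.mS_le l) le_rfl).aestronglyMeasurable) (hv.1 l hl).2 n, ?_⟩
    exact ((h n).mono (Mo.mS_le_mT l) le_rfl).stronglyMeasurable.aestronglyMeasurable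
  · have h0 : (fun ω => v ω (l, n)) =ᵐ[ℙ] fun _ => 0 := by
      filter_upwards [hv.2 l hl] with ω h using h n
    refine ⟨(memLp_congr_ae h0).2 (memLp_const 0), ⟨fun _ => 0, stronglyMeasurable_const, h0⟩⟩

theorem vset_zero (Mo : DistUplinkModel Ω K N L 𝓢) (Lk : Finset (Fin L)) :
    (fun _ _ => 0) ∈ Mo.Vset Lk :=
  ⟨fun l _ => ⟨measurable_const, by simp⟩, fun l _ => by simp⟩

theorem vset_add_smul {Mo : DistUplinkModel Ω K N L 𝓢} {Lk : Finset (Fin L)}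
    {v w : Ω → Fin L × Fin N → ℂ} (hv : v ∈ Mo.Vset Lk) (hw : w ∈ Mo.Vset Lk) (t : ℂ) :
    (fun ω i => v ω i + t * w ω i) ∈ Mo.Vset Lk := by
  refine ⟨fun l hl => ⟨?_, ?_⟩, fun l hl => ?_⟩
  · refine @measurable_pi_lambda _ _ _ (Mo.mS l) _ _ fun n => ?_
    exact (vset_meas hv hl n).add ((vset_meas hw hl n).const_mul t)
  · exact aux_L4 _ fun n => ((vset_good hv).add_smul (vset_good hw) t (l, n)).1
  · filter_upwards [hv.2 l hl, hw.2 l hl] with ω h1 h2 n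
    simp [h1 n, h2 n]

theorem GG_L2 (Mo : DistUplinkModel Ω K N L 𝓢) (i i' : Fin L × Fin N) :
    MemLp (fun ω => ∑ j, Mo.G i j ω * conj (Mo.G i' j ω)) 2 ℙ :=
  memLp_finsetSum _ fun j _ => (Mo.G_L4 i' j).star.mul (Mo.G_L4 i j)

theorem GGv_int (Mo : DistUplinkModel Ω K N L 𝓢) {v : Ω → Fin L × Fin N → ℂ}
    (hv : Mo.Good v) (i i' : Fin L × Fin N) :
    Integrable (fun ω => (∑ j, Mo.G i j ω * conj (Mo.G i' j ω)) * v ω i') ℙ :=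
  have h : MemLp (fun ω => v ω i') 2 ℙ :=
    (hv i').1.mono_exponent (by norm_num)
  (Mo.GG_L2 i i').integrable_mul h

theorem Rs_int (Mo : DistUplinkModel Ω K N L 𝓢) (k) {v : Ω → Fin L × Fin N → ℂ}
    (hv : Mo.Good v) (i) : Integrable (Mo.Rs k v i) ℙ := by
  have h1 : Integrable (fun ω => v ω i) ℙ := (hv i).1.integrable (by norm_num)
  have h2 : Integrable (Mo.G i k) ℙ := (Mo.G_L4 i k).integrable (by norm_num)
  exact (h1.sub h2).add (integrable_finsetSum _ fun i' _ => Mo.GGv_int hv i i')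

theorem wR_int (Mo : DistUplinkModel Ω K N L 𝓢) (k) {v w : Ω → Fin L × Fin N → ℂ}
    (hv : Mo.Good v) (hw : Mo.Good w) (i) :
    Integrable (fun ω => conj (w ω i) * Mo.Rs k v i ω) ℙ := by
  have hw' : Mo.Good (fun ω i' => if i' = i then w ω i' else 0) := by
    intro i'
    by_cases h : i' = i
    · simpa only [h, if_true] using hw i
    · simp only [h, if_false]
      exact ⟨memLp_const 0, aestronglyMeasurable_const⟩
  have := Mo.cross_int k hv hw'
  simpa only [apply_ite conj, map_zero, ite_mul, zero_mul, Finset.sum_ite_eq', Finset.mem_univ,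
    if_true] using this

/-- conditional stationarity -/
def CC (Mo : DistUplinkModel Ω K N L 𝓢) (Lk : Finset (Fin L)) (k : Fin K)
    (v : Ω → Fin L × Fin N → ℂ) : Prop :=
  ∀ l ∈ Lk, ∀ n, ℙ[Mo.Rs k v (l, n) | Mo.mS l] =ᵐ[ℙ] 0

theorem CC_iff (Mo : DistUplinkModel Ω K N L 𝓢) (Lk : Finset (Fin L)) (k : Fin K)
    {v : Ω → Fin L × Fin N → ℂ} (hv : v ∈ Mo.Vset Lk) :
    Mo.CC Lk k v ↔ ∀ w ∈ Mo.Vset Lk, ∫ ω, ∑ i, conj (w ω i) * Mo.Rs k v i ω = 0 := by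
  constructor
  · intro h w hw
    rw [integral_finsetSum _ fun i _ => Mo.wR_int k (vset_good hv) (vset_good hw) i]
    refine Finset.sum_eq_zero fun i _ => ?_
    obtain ⟨l, n⟩ := i
    by_cases hl : l ∈ Lk
    · rw [← integral_condExp (Mo.mS_le l)]
      have hc : AEStronglyMeasurable[Mo.mS l] (fun ω => conj (w ω (l, n))) ℙ :=
        (Complex.continuous_conj.measurable.comp
          (vset_meas hw hl n)).stronglyMeasurable.aestronglyMeasurable
      have h1 := aux_pull hc (Mo.wR_int k (vset_good hv) (vset_good hw) (l, n))
        (Mo.Rs_int k (vset_good hv) (l, n))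
      rw [integral_congr_ae h1]
      refine integral_eq_zero_of_ae ?_
      filter_upwards [h l hl n] with ω hω
      simp [hω]
    · refine integral_eq_zero_of_ae ?_
      filter_upwards [hw.2 l hl] with ω hω
      simp [hω n]
  · intro h l hl n
    refine (ae_eq_condExp_of_forall_setIntegral_eq (g := fun _ => 0) (Mo.mS_le l) (Mo.Rs_int k (vset_good hv) (l, n))
      (fun s _ _ => (integrable_zero _ _ _).integrableOn) ?_ aestronglyMeasurable_const).symm
    intro A hA _
    have hw : (fun ω i => if i = (l, n) then A.indicator (fun _ => (1 : ℂ)) ω else 0)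
        ∈ Mo.Vset Lk := by
      refine ⟨fun l' hl' => ⟨?_, ?_⟩, fun l' hl' => ?_⟩
      · refine @measurable_pi_lambda _ _ _ (Mo.mS l') _ _ fun n' => ?_
        by_cases hh : ((l', n') : Fin L × Fin N) = (l, n)
        · obtain ⟨rfl, rfl⟩ := Prod.mk.inj hh
          simp only [if_true]
          exact measurable_const.indicator hA
        · simp only [hh, if_false]
          exact measurable_const
      · refine aux_L4 _ fun n' => ?_
        by_cases hh : ((l', n') : Fin L × Fin N) = (l, n)
        · simp only [hh, if_true]
          exact (memLp_const (1 : ℂ)).indicator (Mo.mS_le l _ hA)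
        · simp only [hh, if_false]
          exact memLp_const 0
      · refine Filter.Eventually.of_forall fun ω n' => ?_
        refine if_neg fun hh => hl' ?_
        rw [(Prod.mk.inj hh).1]
        exact hl
    have h1 := h _ hw
    simp only [apply_ite conj, map_zero, ite_mul, zero_mul, Finset.sum_ite_eq', Finset.mem_univ,
      if_true] at h1
    rw [integral_zero, ← integral_indicator (f := Mo.Rs k v (l, n)) (Mo.mS_le l _ hA), ← h1]
    refine integral_congr_ae (Filter.Eventually.of_forall fun ω => ?_)
    by_cases hω : ω ∈ A <;> simp [hω]

theorem blk_eq (Mo : DistUplinkModel Ω K N L 𝓢) (l l' : Fin L) (n n' : Fin N) (ω : Ω) :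
    (Mo.Hblk l ω * Mo.Pmat ω * (Mo.Hblk l' ω)ᴴ) n n'
      = ∑ j, Mo.G (l, n) j ω * conj (Mo.G (l', n') j ω) := by
  rw [Matrix.mul_apply]
  refine Finset.sum_congr rfl fun j _ => ?_
  simp only [Pmat, Matrix.mul_diagonal, Hblk, Matrix.conjTranspose_apply, Matrix.of_apply, G,
    map_mul, Complex.conj_ofReal]
  have : (Mo.p ω j : ℂ) = (Real.sqrt (Mo.p ω j) : ℂ) * (Real.sqrt (Mo.p ω j) : ℂ) := by
    rw [← Complex.ofReal_mul, Real.mul_self_sqrt (Mo.hp_nonneg ω j)]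
  rw [this, starRingEnd_apply]
  ring

theorem condExp_Rs (Mo : DistUplinkModel Ω K N L 𝓢) (Lk : Finset (Fin L)) (k : Fin K)
    {v : Ω → Fin L × Fin N → ℂ} (hv : v ∈ Mo.Vset Lk) {l : Fin L} (hl : l ∈ Lk)
    (hp : Measurable[Mo.mS l] Mo.p) (n : Fin N) :
    ∀ᵐ ω, (ℙ[Mo.Rs k v (l, n) | Mo.mS l]) ω = v ω (l, n)
      - (Real.sqrt (Mo.p ω k) : ℂ) * (ℙ[fun ω' => Mo.H ω' (l, n) k | Mo.mS l]) ω
      + ∑ n', v ω (l, n') *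
        (ℙ[fun ω' => ∑ j, Mo.G (l, n) j ω' * conj (Mo.G (l, n') j ω') | Mo.mS l]) ω
      + ∑ j ∈ Lk.erase l, (ℙ[fun ω' => ∑ n', (∑ q, Mo.G (l, n) q ω' * conj (Mo.G (j, n') q ω'))
          * v ω' (j, n') | Mo.mS l]) ω := by
  have hg := vset_good hv
  let f1 : Ω → ℂ := fun ω => v ω (l, n)
  let f2 : Ω → ℂ := fun ω => (Real.sqrt (Mo.p ω k) : ℂ) * Mo.H ω (l, n) k
  let f3 : Ω → ℂ := fun ω => ∑ n', v ω (l, n') * ∑ j, Mo.G (l, n) j ω * conj (Mo.G (l, n') j ω)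
  let b : Fin L → Ω → ℂ := fun j ω' =>
    ∑ n', (∑ q, Mo.G (l, n) q ω' * conj (Mo.G (j, n') q ω')) * v ω' (j, n')
  let f4 : Ω → ℂ := ∑ j ∈ Lk.erase l, b j
  have i1 : Integrable f1 ℙ := (hg (l, n)).1.integrable (by norm_num)
  have i2 : Integrable f2 ℙ := (Mo.G_L4 (l, n) k).integrable (by norm_num)
  have ib : ∀ j, Integrable (b j) ℙ := fun j =>
    integrable_finsetSum _ fun n' _ => Mo.GGv_int hg (l, n) (j, n')
  have i3' : ∀ n', Integrable (fun ω => v ω (l, n') *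
      ∑ j, Mo.G (l, n) j ω * conj (Mo.G (l, n') j ω)) ℙ := fun n' => by
    simpa only [mul_comm] using Mo.GGv_int hg (l, n) (l, n')
  have i3 : Integrable f3 ℙ := integrable_finsetSum _ fun n' _ => i3' n'
  have i4 : Integrable f4 ℙ := integrable_finsetSum' _ fun j _ => ib j
  have hR : Mo.Rs k v (l, n) =ᵐ[ℙ] f1 - f2 + f3 + f4 := by
    have h0 : ∀ᵐ ω, ∀ j, j ∉ Lk → ∀ n, v ω (j, n) = 0 := by
      rw [ae_all_iff]; intro j
      by_cases hj : j ∈ Lk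
      · simp [hj]
      · filter_upwards [hv.2 j hj] with ω h _ using h
    filter_upwards [h0] with ω h0
    have e1 : ∑ i', (∑ j, Mo.G (l, n) j ω * conj (Mo.G i' j ω)) * v ω i' = ∑ j, b j ω := by
      rw [Fintype.sum_prod_type]
    have e2 : ∑ j, b j ω = ∑ j ∈ Lk, b j ω := by
      symm
      refine Finset.sum_subset (Finset.subset_univ _) fun j _ hj => ?_
      exact Finset.sum_eq_zero fun n' _ => by rw [h0 j hj n', mul_zero]
    have e3 : b l ω = f3 ω := Finset.sum_congr rfl fun n' _ => mul_comm _ _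
    simp only [Rs, e1, e2, Pi.add_apply, Pi.sub_apply]
    rw [← Finset.add_sum_erase _ _ hl, e3]
    simp only [f1, f2, f4, Finset.sum_apply, G]
    ring
  have c0 := condExp_congr_ae (m := Mo.mS l) hR
  have c1 := condExp_add ((i1.sub i2).add i3) i4 (Mo.mS l)
  have c2 := condExp_add (i1.sub i2) i3 (Mo.mS l)
  have c3 := condExp_sub i1 i2 (Mo.mS l)
  have d1 : ℙ[f1 | Mo.mS l] = f1 :=
    condExp_of_stronglyMeasurable (Mo.mS_le l) (vset_meas hv hl n).stronglyMeasurable i1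
  have hps : AEStronglyMeasurable[Mo.mS l] (fun ω => (Real.sqrt (Mo.p ω k) : ℂ)) ℙ :=
    (Complex.measurable_ofReal.comp (Real.continuous_sqrt.measurable.comp
      ((measurable_pi_apply k).comp hp))).stronglyMeasurable.aestronglyMeasurable
  have d2 := aux_pull hps i2 ((Mo.H_L4 (l, n) k).integrable (by norm_num))
  have d3 := aux_pull_sum (m := Mo.mS l) (μ := ℙ) Finset.univ (c := fun n' ω => v ω (l, n'))
    (f := fun n' ω => ∑ j, Mo.G (l, n) j ω * conj (Mo.G (l, n') j ω))
    (fun n' _ => (vset_meas hv hl n').stronglyMeasurable.aestronglyMeasurable)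
    (fun n' _ => i3' n') (fun n' _ => (Mo.GG_L2 (l, n) (l, n')).integrable (by norm_num))
  have d4 := condExp_finsetSum (s := Lk.erase l) (fun j _ => ib j) (Mo.mS l)
  filter_upwards [c0, c1, c2, c3, d2, d3, d4] with ω c0 c1 c2 c3 d2 d3 d4
  rw [c0, c1, Pi.add_apply, c2, Pi.add_apply, c3, Pi.sub_apply, d1]
  rw [show (ℙ[f2 | Mo.mS l]) ω = _ from d2, show (ℙ[f3 | Mo.mS l]) ω = _ from d3,
    show (ℙ[f4 | Mo.mS l]) ω = _ from d4, Finset.sum_apply]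

theorem CC_iff_opt (Mo : DistUplinkModel Ω K N L 𝓢) (Lk : Finset (Fin L)) (k : Fin K)
    (hp : ∀ l ∈ Lk, Measurable[Mo.mS l] Mo.p)
    {v : Ω → Fin L × Fin N → ℂ} (hv : v ∈ Mo.Vset Lk) :
    Mo.CC Lk k v ↔ Mo.OptCond Lk k v := by
  refine forall₂_congr fun l hl => ?_
  have h1 : (∀ n, ℙ[Mo.Rs k v (l, n) | Mo.mS l] =ᵐ[ℙ] 0) ↔
      ∀ᵐ ω, ∀ n, (ℙ[Mo.Rs k v (l, n) | Mo.mS l]) ω = 0 := by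
    rw [ae_all_iff]; rfl
  rw [h1]
  have h2 := ae_all_iff.2 fun n => Mo.condExp_Rs Lk k hv hl (hp l hl) n
  have h3 := aux_psd (m := Mo.mS l) (μ := ℙ) (fun n => Mo.G (l, n))
    (fun n n' => (Mo.GG_L2 (l, n) (l, n')).integrable (by norm_num))
  refine Filter.eventually_congr ?_
  filter_upwards [h2, h3] with ω h2 h3
  have hb : ∀ j n, (fun ω' => ((Mo.Hblk l ω' * Mo.Pmat ω' * (Mo.Hblk j ω')ᴴ) *ᵥ
      fun n' => v ω' (j, n')) n) = fun ω' =>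
      ∑ n', (∑ q, Mo.G (l, n) q ω' * conj (Mo.G (j, n') q ω')) * v ω' (j, n') := by
    intro j n
    funext ω'
    simp only [Matrix.mulVec, dotProduct, blk_eq]
  simp only [hb, blk_eq]
  have hu := aux_unit (Matrix.of fun n n' =>
    (ℙ[fun ω' => ∑ j, Mo.G (l, n) j ω' * conj (Mo.G (l, n') j ω') | Mo.mS l]) ω) h3
  rw [aux_solve _ hu (fun n => v ω (l, n)), funext_iff]
  refine forall_congr' fun n => ?_
  rw [h2 n]
  simp only [Matrix.mulVec, dotProduct, Pi.sub_apply, Finset.sum_apply]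
  have e1 : ∑ x, ((Matrix.of fun n n' =>
    (ℙ[fun ω' => ∑ j, Mo.G (l, n) j ω' * conj (Mo.G (l, n') j ω') | Mo.mS l]) ω) + 1) n x
      * v ω (l, x) = (∑ n', v ω (l, n') *
        (ℙ[fun ω' => ∑ j, Mo.G (l, n) j ω' * conj (Mo.G (l, n') j ω') | Mo.mS l]) ω)
          + v ω (l, n) := by
    simp only [Matrix.add_apply, Matrix.of_apply, add_mul, Finset.sum_add_distrib, Matrix.one_apply,
      ite_mul, one_mul, zero_mul, Finset.sum_ite_eq, Finset.mem_univ, if_true]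
    rw [Finset.sum_congr rfl fun n' _ => mul_comm _ _]
  have e2 : ∑ x, (Matrix.of fun n j => (ℙ[fun ω' => Mo.H ω' (l, n) j | Mo.mS l]) ω) n x *
      ∑ y, Mo.Psqrt ω x y * (Pi.single k (1 : ℂ) : Fin K → ℂ) y
      = (Real.sqrt (Mo.p ω k) : ℂ) * (ℙ[fun ω' => Mo.H ω' (l, n) k | Mo.mS l]) ω := by
    simp [Psqrt, Matrix.diagonal_apply, Pi.single_apply, mul_comm]
  rw [e1, e2]
  constructor
  · intro h; linear_combination h
  · intro h; linear_combination h

theorem Qf_nonneg (Mo : DistUplinkModel Ω K N L 𝓢) (w : Ω → Fin L × Fin N → ℂ) : 0 ≤ Mo.Qf w :=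
  integral_nonneg fun ω => by positivity

theorem min_iff (Mo : DistUplinkModel Ω K N L 𝓢) (Lk : Finset (Fin L)) (k : Fin K)
    {v : Ω → Fin L × Fin N → ℂ} (hv : v ∈ Mo.Vset Lk) :
    (∀ u ∈ Mo.Vset Lk, Mo.MSE k v ≤ Mo.MSE k u) ↔
      ∀ w ∈ Mo.Vset Lk, ∫ ω, ∑ i, conj (w ω i) * Mo.Rs k v i ω = 0 := by
  have hvg := vset_good hv
  constructor
  · intro h
    have hre : ∀ w ∈ Mo.Vset Lk, (∫ ω, ∑ i, conj (w ω i) * Mo.Rs k v i ω).re = 0 := by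
      intro w hw
      set β := (∫ ω, ∑ i, conj (w ω i) * Mo.Rs k v i ω).re with hβ
      have hq := Mo.Qf_nonneg w
      have h1 : ∀ t : ℝ, 0 ≤ 2 * t * β + t ^ 2 * Mo.Qf w := by
        intro t
        have := h _ (vset_add_smul hv hw (t : ℂ))
        rw [Mo.MSE_quad k hvg (vset_good hw) t] at this
        linarith
      have h2 := h1 (-β / (Mo.Qf w + 1))
      have hpos : 0 < Mo.Qf w + 1 := by linarith
      have h3 : 2 * (-β / (Mo.Qf w + 1)) * β + (-β / (Mo.Qf w + 1)) ^ 2 * Mo.Qf w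
          = - (β ^ 2 * (Mo.Qf w + 2)) / (Mo.Qf w + 1) ^ 2 := by
        field_simp; ring
      rw [h3, neg_div, Left.nonneg_neg_iff] at h2
      have h4 : β ^ 2 * (Mo.Qf w + 2) ≤ 0 := by
        by_contra hc
        push Not at hc
        exact absurd h2 (not_le.2 (by positivity))
      nlinarith [sq_nonneg β]
    intro w hw
    refine Complex.ext (hre w hw) ?_
    have h1 := hre _ (vset_add_smul (vset_zero Mo Lk) hw Complex.I)
    have e : ∀ ω, ∑ i, conj (0 + Complex.I * w ω i) * Mo.Rs k v i ω
        = - Complex.I * ∑ i, conj (w ω i) * Mo.Rs k v i ω := by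
      intro ω
      rw [Finset.mul_sum]
      refine Finset.sum_congr rfl fun i _ => ?_
      rw [zero_add, map_mul, Complex.conj_I]; ring
    simp_rw [e] at h1
    rw [integral_const_mul] at h1
    simpa using h1
  · intro h u hu
    have hw := vset_add_smul hu hv (-1)
    have := Mo.MSE_quad k hvg (vset_good hw) 1
    rw [h _ hw] at this
    have e : (fun ω i => v ω i + ((1 : ℝ) : ℂ) * (u ω i + -1 * v ω i)) = u := by
      ext ω i; push_cast; ring
    rw [e] at this
    have hq := Mo.Qf_nonneg (fun ω i => u ω i + -1 * v ω i)
    rw [this]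
    simp only [Complex.zero_re]
    linarith

theorem min_unique (Mo : DistUplinkModel Ω K N L 𝓢) (Lk : Finset (Fin L)) (k : Fin K)
    {v u : Ω → Fin L × Fin N → ℂ} (hv : v ∈ Mo.Vset Lk) (hu : u ∈ Mo.Vset Lk)
    (h1 : ∀ w ∈ Mo.Vset Lk, ∫ ω, ∑ i, conj (w ω i) * Mo.Rs k v i ω = 0)
    (h2 : ∀ w ∈ Mo.Vset Lk, ∫ ω, ∑ i, conj (w ω i) * Mo.Rs k u i ω = 0) : v =ᵐ[ℙ] u := by
  have hw := vset_add_smul hu hv (-1)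
  have := Mo.MSE_quad k (vset_good hv) (vset_good hw) 1
  rw [h1 _ hw] at this
  have e : (fun ω i => v ω i + ((1 : ℝ) : ℂ) * (u ω i + -1 * v ω i)) = u := by
    ext ω i; push_cast; ring
  rw [e] at this
  have h3 := (Mo.min_iff Lk k hu).2 h2 v hv
  have h4 := Mo.Qf_nonneg (fun ω i => u ω i + -1 * v ω i)
  simp only [Complex.zero_re] at this
  have h5 : Mo.Qf (fun ω i => u ω i + -1 * v ω i) = 0 := by linarith
  unfold Qf at h5
  rw [integral_eq_zero_iff_of_nonneg (fun ω => by positivity)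
    (sq_int _ fun s => (Mo.Fc_good (vset_good hw) s).1)] at h5
  filter_upwards [h5] with ω h
  ext i
  simp only [Pi.zero_apply] at h
  rw [Finset.sum_eq_zero_iff_of_nonneg (fun _ _ => by positivity)] at h
  have := h (Sum.inr i) (mem_univ _)
  simp only [Fc, Sum.elim_inr, norm_neg, RCLike.norm_conj] at this
  have h6 : u ω i + -1 * v ω i = 0 := by simpa using this
  linear_combination -h6

end DistUplinkModel

/-- If `p` is `σ(S_l)`-measurable for every `l` in the serving cluster, then
`vopt ∈ 𝒱_k` attains `inf_{v ∈ 𝒱_k} MSE_k(v)` if and only if it satisfies the team-MMSE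
stationarity conditions; moreover, these conditions have at most one solution in `𝒱_k`
(up to almost-everywhere equality). -/
theorem mse_minimizer_iff_stationarity
    {Ω : Type*} [MeasureSpace Ω] [IsProbabilityMeasure (ℙ : Measure Ω)]
    {K N L : ℕ} {𝓢 : Fin L → Type*} [∀ l, MeasurableSpace (𝓢 l)]
    (Mo : DistUplinkModel Ω K N L 𝓢) (Lk : Finset (Fin L)) (k : Fin K)
    (hp : ∀ l ∈ Lk, Measurable[Mo.mS l] Mo.p)
    (vopt : Ω → Fin L × Fin N → ℂ) (hvopt : vopt ∈ Mo.Vset Lk) :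
    ((∀ v ∈ Mo.Vset Lk, Mo.MSE k vopt ≤ Mo.MSE k v) ↔ Mo.OptCond Lk k vopt) ∧
    ∀ v ∈ Mo.Vset Lk, ∀ v' ∈ Mo.Vset Lk,
      Mo.OptCond Lk k v → Mo.OptCond Lk k v' → v =ᵐ[ℙ] v' := by
  refine ⟨?_, fun v hv v' hv' h h' => ?_⟩
  · rw [Mo.min_iff Lk k hvopt, ← Mo.CC_iff Lk k hvopt, Mo.CC_iff_opt Lk k hp hvopt]
  · refine Mo.min_unique Lk k hv hv' ?_ ?_
    · exact (Mo.CC_iff Lk k hv).1 ((Mo.CC_iff_opt Lk k hp hv).2 h)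
    · exact (Mo.CC_iff Lk k hv').1 ((Mo.CC_iff_opt Lk k hp hv').2 h')
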